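/- arXiv:math/0606056 — 4 statements merged into one kernel-verified Lean document; each statement's English description precedes it below -/
import Mathlib

section
/- Fix n ≥ 1. For a partition λ of n, let b_i (1 ≤ i ≤ n) be the number of parts of λ of size i, and set d_i = b_1 + 2b_2 + ⋯ + i·b_i + i·(b_{i+1} + ⋯ + b_n). Define c(λ) = ∏_{i=1}^{n} ∏_{k=1}^{b_i} (q^{d_i} − q^{d_i − k}). Then in ℚ: Σ_{λ ⊢ n} 1/c(λ) = 1 / ( q^n · (1 − q^{−1})(1 − q^{−2})⋯(1 − q^{−n}) ); equivalently, γ_n · Σ_{λ ⊢ n} 1/c(λ) = q^{n(n−1)}. -/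
/-- `gam q n` is the order of `GL_n(F_q)`: `∏_{i=0}^{n-1} (q^n - q^i)`. -/
def gam (q n : ℕ) : ℕ := ∏ i ∈ Finset.range n, (q ^ n - q ^ i)

section GaussBinomial

variable {K : Type*} [Field K]

/-- The `q`-Pochhammer symbol `(u; u)_n = ∏_{i=1}^{n} (1 - u^i)`. -/
def qPoch (u : K) (n : ℕ) : K := ∏ i ∈ Finset.range n, (1 - u ^ (i + 1))

/-- The Gaussian binomial coefficient with parameter `u`, defined by the `q`-Pascal rule. -/
def gaussBinom (u : K) : ℕ → ℕ → K
  | _, 0 => 1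
  | 0, _ + 1 => 0
  | n + 1, k + 1 => u ^ (k + 1) * gaussBinom u n (k + 1) + gaussBinom u n k

theorem qPoch_zero (u : K) : qPoch u 0 = 1 := by simp [qPoch]

theorem qPoch_succ (u : K) (n : ℕ) : qPoch u (n + 1) = qPoch u n * (1 - u ^ (n + 1)) :=
  Finset.prod_range_succ _ _

theorem qPoch_ne_zero {u : K} (hu : ∀ k, u ^ (k + 1) ≠ 1) (n : ℕ) : qPoch u n ≠ 0 :=
  Finset.prod_ne_zero_iff.2 fun i _ => sub_ne_zero.2 (hu i).symm

theorem gaussBinom_zero_right (u : K) (n : ℕ) : gaussBinom u n 0 = 1 := by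
  cases n <;> rfl

theorem gaussBinom_zero_succ (u : K) (k : ℕ) : gaussBinom u 0 (k + 1) = 0 := rfl

theorem gaussBinom_succ_succ (u : K) (n k : ℕ) :
    gaussBinom u (n + 1) (k + 1) = u ^ (k + 1) * gaussBinom u n (k + 1) + gaussBinom u n k := rfl

theorem gaussBinom_eq_zero_of_lt (u : K) {n k : ℕ} (h : n < k) : gaussBinom u n k = 0 := by
  induction n generalizing k with
  | zero => obtain ⟨k, rfl⟩ := Nat.exists_eq_add_of_lt h; simp [gaussBinom_zero_succ]
  | succ n ih =>
    obtain ⟨k, rfl⟩ : ∃ j, k = j + 1 := ⟨k - 1, by omega⟩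
    rw [gaussBinom_succ_succ, ih (by omega), ih (by omega)]
    simp

theorem gaussBinom_self (u : K) (n : ℕ) : gaussBinom u n n = 1 := by
  induction n with
  | zero => rfl
  | succ n ih => simp [gaussBinom_succ_succ, ih, gaussBinom_eq_zero_of_lt u (Nat.lt_succ_self n)]

theorem gaussBinom_add_mul_qPoch (u : K) (s t : ℕ) :
    gaussBinom u (s + t) s * (qPoch u s * qPoch u t) = qPoch u (s + t) := by
  induction s generalizing t with
  | zero => simp [gaussBinom_zero_right, qPoch_zero]
  | succ s ihs =>
    induction t with
    | zero => simp [gaussBinom_self, qPoch_zero]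
    | succ t iht =>
      have h1 := ihs (t + 1)
      have e1 : s + 1 + (t + 1) = (s + (t + 1)) + 1 := by omega
      have e2 : s + 1 + t = s + (t + 1) := by omega
      rw [e2] at iht
      rw [e1, gaussBinom_succ_succ, qPoch_succ u (s + (t + 1)), qPoch_succ u t]
      rw [qPoch_succ u t] at h1
      rw [qPoch_succ u s] at iht ⊢
      linear_combination (u ^ (s + 1) * (1 - u ^ (t + 1))) * iht + (1 - u ^ (s + 1)) * h1

theorem gaussBinom_symm {u : K} (hu : ∀ k, u ^ (k + 1) ≠ 1) (s t : ℕ) :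
    gaussBinom u (s + t) s = gaussBinom u (s + t) t := by
  have h1 := gaussBinom_add_mul_qPoch u s t
  have h2 := gaussBinom_add_mul_qPoch u t s
  rw [add_comm t s, mul_comm (qPoch u t)] at h2
  exact mul_right_cancel₀ (mul_ne_zero (qPoch_ne_zero hu s) (qPoch_ne_zero hu t)) (h1.trans h2.symm)

/-- A common form of the `q`-Vandermonde identity and its limit, for any array `f` satisfying the
`q`-Pascal rule. -/
theorem sum_gaussBinom_mul (u : K) (f : ℕ → ℕ → K)
    (hf : ∀ R k, f (R + 1) (k + 1) = u ^ (k + 1) * f R (k + 1) + f R k) (N a R : ℕ) :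
    ∑ s ∈ Finset.range (N + 1), u ^ (s * (s + a)) * gaussBinom u N s * f R (s + a)
      = f (R + N) (a + N) := by
  induction N generalizing a R with
  | zero => simp [gaussBinom_zero_right]
  | succ N ih =>
    have key := ih (a + 1) (R + 1)
    rw [show R + 1 + N = R + (N + 1) by omega, show a + 1 + N = a + (N + 1) by omega] at key
    rw [← key, Finset.sum_range_succ']
    have hsplit : ∀ s, u ^ ((s + 1) * (s + 1 + a)) * gaussBinom u (N + 1) (s + 1) * f R (s + 1 + a)
        = u ^ ((s + 1) * (s + 1 + a + 1)) * gaussBinom u N (s + 1) * f R (s + 1 + a)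
          + u ^ (s * (s + (a + 1))) * gaussBinom u N s * (u ^ (s + a + 1) * f R (s + a + 1)) := by
      intro s
      rw [gaussBinom_succ_succ, show s + 1 + a = s + a + 1 by omega]
      ring
    simp only [hsplit, Finset.sum_add_distrib]
    have hshift := Finset.sum_range_succ'
      (fun s => u ^ (s * (s + a + 1)) * gaussBinom u N s * f R (s + a)) (N + 1)
    rw [Finset.sum_range_succ, gaussBinom_eq_zero_of_lt u (Nat.lt_succ_self N)] at hshift
    simp only [mul_zero, zero_mul, add_zero, zero_add, pow_zero, gaussBinom_zero_right, one_mul]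
      at hshift ⊢
    rw [add_right_comm, ← hshift, ← Finset.sum_add_distrib]
    refine Finset.sum_congr rfl fun s _ => ?_
    rw [← add_assoc s a 1, hf]
    ring

end GaussBinomial

section PartitionMultisets

/-- The multisets of positive integers with sum `n`. -/
def partMultisets (n : ℕ) : Finset (Multiset ℕ) :=
  Finset.univ.image (Nat.Partition.parts (n := n))

theorem mem_partMultisets {n : ℕ} {A : Multiset ℕ} :
    A ∈ partMultisets n ↔ (∀ x ∈ A, 0 < x) ∧ A.sum = n := by
  simp only [partMultisets, Finset.mem_image, Finset.mem_univ, true_and]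
  constructor
  · rintro ⟨lam, rfl⟩
    exact ⟨fun x hx => lam.parts_pos hx, lam.parts_sum⟩
  · rintro ⟨h1, h2⟩
    exact ⟨⟨A, fun hx => h1 _ hx, h2⟩, rfl⟩

theorem sum_partition_eq_sum_partMultisets {M : Type*} [AddCommMonoid M] (n : ℕ)
    (F : Multiset ℕ → M) :
    ∑ lam : n.Partition, F lam.parts = ∑ A ∈ partMultisets n, F A := by
  rw [partMultisets, Finset.sum_image]
  intro a _ b _ h
  exact Nat.Partition.ext h

/-- Adjoin to the Young diagram of `B` a first column of length `s`. -/
def addColumn (s : ℕ) (B : Multiset ℕ) : Multiset ℕ :=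
  B.map (· + 1) + Multiset.replicate (s - B.card) 1

/-- Delete the first column of a Young diagram. -/
def removeColumn (A : Multiset ℕ) : Multiset ℕ :=
  (A.filter (1 < ·)).map (· - 1)

theorem card_addColumn {s : ℕ} {B : Multiset ℕ} (h : B.card ≤ s) : (addColumn s B).card = s := by
  simp [addColumn]; omega

theorem sum_map_addColumn {s : ℕ} {B : Multiset ℕ} (f : ℕ → ℕ) :
    ((addColumn s B).map f).sum = (B.map fun x => f (x + 1)).sum + (s - B.card) * f 1 := by
  simp [addColumn]

theorem sum_addColumn {s : ℕ} {B : Multiset ℕ} (h : B.card ≤ s) :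
    (addColumn s B).sum = B.sum + s := by
  have := sum_map_addColumn (s := s) (B := B) id
  simp [Multiset.sum_map_add] at this
  omega

theorem removeColumn_addColumn {s : ℕ} {B : Multiset ℕ} (hB : ∀ x ∈ B, 0 < x) :
    removeColumn (addColumn s B) = B := by
  have h1 : (Multiset.replicate (s - B.card) 1).filter (1 < ·) = 0 := by
    rw [Multiset.filter_eq_nil]
    intro a ha
    simp [Multiset.eq_of_mem_replicate ha]
  have h2 : (B.map (· + 1)).filter (1 < ·) = B.map (· + 1) := by
    rw [Multiset.filter_eq_self]
    intro a ha
    obtain ⟨x, hx, rfl⟩ := Multiset.mem_map.1 ha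
    have := hB x hx
    omega
  rw [removeColumn, addColumn, Multiset.filter_add, h1, h2]
  simp

theorem card_removeColumn_le (A : Multiset ℕ) : (removeColumn A).card ≤ A.card := by
  rw [removeColumn, Multiset.card_map]
  exact Multiset.card_le_card (Multiset.filter_le _ _)

theorem addColumn_removeColumn {A : Multiset ℕ} (hA : ∀ x ∈ A, 0 < x) :
    addColumn A.card (removeColumn A) = A := by
  have h1 : (removeColumn A).map (· + 1) = A.filter (1 < ·) := by
    rw [removeColumn, Multiset.map_map]
    refine (Multiset.map_congr rfl fun x hx => ?_).trans (Multiset.map_id _)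
    have := (Multiset.mem_filter.1 hx).2
    simp only [Function.comp, id]
    omega
  have h2 : A.filter (¬ 1 < ·) = Multiset.replicate (A.card - (removeColumn A).card) 1 := by
    rw [Multiset.eq_replicate]
    constructor
    · have := congrArg Multiset.card (Multiset.filter_add_not (1 < ·) A)
      rw [Multiset.card_add] at this
      rw [removeColumn, Multiset.card_map]
      omega
    · intro x hx
      obtain ⟨hx, h⟩ := Multiset.mem_filter.1 hx
      have := hA x hx
      omega
  rw [addColumn, h1, ← h2, Multiset.filter_add_not]

theorem pos_of_mem_addColumn {s x : ℕ} {B : Multiset ℕ} (hx : x ∈ addColumn s B) : 0 < x := by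
  rcases Multiset.mem_add.1 hx with h | h
  · obtain ⟨y, -, rfl⟩ := Multiset.mem_map.1 h
    omega
  · simp [Multiset.eq_of_mem_replicate h]

theorem pos_of_mem_removeColumn {x : ℕ} {A : Multiset ℕ} (hx : x ∈ removeColumn A) : 0 < x := by
  obtain ⟨y, hy, rfl⟩ := Multiset.mem_map.1 hx
  have := (Multiset.mem_filter.1 hy).2
  omega

theorem card_le_sum_of_pos {A : Multiset ℕ} (hA : ∀ x ∈ A, 0 < x) : A.card ≤ A.sum := by
  simpa using Multiset.card_nsmul_le_sum (s := A) (a := 1) fun x hx => hA x hx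

/-- Summation over partitions of `m + 1`, organised by the length of the first column. -/
theorem sum_partMultisets_succ {M : Type*} [AddCommMonoid M] (m : ℕ) (F : Multiset ℕ → M) :
    ∑ A ∈ partMultisets (m + 1), F A = ∑ s ∈ Finset.range (m + 1),
      ∑ B ∈ partMultisets (m - s) with B.card ≤ s + 1, F (addColumn (s + 1) B) := by
  have hcard : ∀ A ∈ partMultisets (m + 1), 0 < A.card ∧ A.card ≤ m + 1 := by
    intro A hA
    obtain ⟨hpos, hsum⟩ := mem_partMultisets.1 hA
    refine ⟨Multiset.card_pos.2 ?_, hsum ▸ card_le_sum_of_pos hpos⟩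
    rintro rfl
    simp at hsum
  rw [← Finset.sum_fiberwise_of_maps_to (t := Finset.range (m + 1)) (g := fun A => A.card - 1)]
  · refine Finset.sum_congr rfl fun s hs => ?_
    rw [Finset.mem_range] at hs
    refine Finset.sum_bij' (fun A _ => removeColumn A) (fun B _ => addColumn (s + 1) B) ?_ ?_ ?_ ?_ ?_
    · intro A hA
      obtain ⟨hA, hc⟩ := Finset.mem_filter.1 hA
      have h0 := hcard A hA
      obtain ⟨hpos, hsum⟩ := mem_partMultisets.1 hA
      have hle := card_removeColumn_le A
      have h2 := sum_addColumn hle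
      rw [addColumn_removeColumn hpos] at h2
      rw [Finset.mem_filter, mem_partMultisets]
      exact ⟨⟨fun x hx => pos_of_mem_removeColumn hx, by omega⟩, by omega⟩
    · intro B hB
      obtain ⟨hB, hc⟩ := Finset.mem_filter.1 hB
      obtain ⟨hpos, hsum⟩ := mem_partMultisets.1 hB
      rw [Finset.mem_filter, mem_partMultisets, card_addColumn hc, sum_addColumn hc]
      exact ⟨⟨fun x hx => pos_of_mem_addColumn hx, by omega⟩, by omega⟩
    · intro A hA
      obtain ⟨hA, hc⟩ := Finset.mem_filter.1 hA
      have h0 := hcard A hA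
      rw [show s + 1 = A.card by omega, addColumn_removeColumn (mem_partMultisets.1 hA).1]
    · intro B hB
      exact removeColumn_addColumn (mem_partMultisets.1 (Finset.mem_filter.1 hB).1).1
    · intro A hA
      obtain ⟨hA, hc⟩ := Finset.mem_filter.1 hA
      have h0 := hcard A hA
      rw [show s + 1 = A.card by omega, addColumn_removeColumn (mem_partMultisets.1 hA).1]
  · intro A hA
    have := hcard A hA
    rw [Finset.mem_range]
    omega

end PartitionMultisets

section Weight

variable {K : Type*} [Field K]

/-- The number of cells in the first `i` columns of the Young diagram of `A`. -/
def columnCells (A : Multiset ℕ) (i : ℕ) : ℕ := (A.map fun x => min x i).sum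

/-- The reciprocal of Kung's product for a multiset with parts at most `N`, where `u = q⁻¹`. -/
def kungWeight (u : K) (N : ℕ) (A : Multiset ℕ) : K :=
  ∏ i ∈ Finset.range N,
    u ^ (columnCells A (i + 1) * A.count (i + 1)) / qPoch u (A.count (i + 1))

theorem columnCells_addColumn {s : ℕ} {B : Multiset ℕ} (h : B.card ≤ s) (i : ℕ) :
    columnCells (addColumn s B) (i + 1) = columnCells B i + s := by
  rw [columnCells, sum_map_addColumn]
  simp only [Nat.add_min_add_right, Multiset.sum_map_add, columnCells]
  simp
  omega

theorem count_one_addColumn {s : ℕ} {B : Multiset ℕ} (hB : ∀ x ∈ B, 0 < x) :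
    (addColumn s B).count 1 = s - B.card := by
  have h0 : (B.map (· + 1)).count 1 = 0 := by
    rw [Multiset.count_eq_zero, Multiset.mem_map]
    rintro ⟨x, hx, h⟩
    have := hB x hx
    omega
  rw [addColumn, Multiset.count_add, h0, Multiset.count_replicate_self, zero_add]

theorem count_add_two_addColumn {s : ℕ} {B : Multiset ℕ} (i : ℕ) :
    (addColumn s B).count (i + 1 + 1) = B.count (i + 1) := by
  rw [addColumn, Multiset.count_add, Multiset.count_replicate, if_neg (by omega), add_zero]
  exact Multiset.count_map_eq_count' (· + 1) B (add_left_injective 1) (i + 1)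

theorem sum_range_count_succ {N : ℕ} {B : Multiset ℕ} (hB : ∀ x ∈ B, 0 < x ∧ x ≤ N) :
    ∑ i ∈ Finset.range N, B.count (i + 1) = B.card := by
  rw [← Multiset.sum_count_eq_card (s := Finset.Icc 1 N) fun a ha => Finset.mem_Icc.2 (hB a ha),
    ← Finset.Ico_add_one_right_eq_Icc, Finset.sum_Ico_eq_sum_range]
  simp [add_comm]

theorem kungWeight_addColumn (u : K) {N s : ℕ} {B : Multiset ℕ}
    (hB : ∀ x ∈ B, 0 < x ∧ x ≤ N) (hs : B.card ≤ s) :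
    kungWeight u (N + 1) (addColumn s B)
      = u ^ (s * s) / qPoch u (s - B.card) * kungWeight u N B := by
  rw [kungWeight, Finset.prod_range_succ', kungWeight]
  simp only [columnCells_addColumn hs, count_add_two_addColumn, zero_add,
    count_one_addColumn fun x hx => (hB x hx).1]
  have h0 : columnCells B 0 = 0 := by simp [columnCells]
  have h1 : ∀ i, u ^ ((columnCells B (i + 1) + s) * B.count (i + 1)) / qPoch u (B.count (i + 1))
      = u ^ (s * B.count (i + 1)) *
        (u ^ (columnCells B (i + 1) * B.count (i + 1)) / qPoch u (B.count (i + 1))) := by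
    intro i
    rw [add_mul, pow_add]
    ring
  simp only [h1, Finset.prod_mul_distrib, Finset.prod_pow_eq_pow_sum, ← Finset.mul_sum,
    sum_range_count_succ hB, h0, zero_add]
  have h2 : u ^ (s * s) = u ^ (s * B.card) * u ^ (s * (s - B.card)) := by
    rw [← pow_add, ← mul_add, Nat.add_sub_cancel' hs]
  rw [h2]
  ring

theorem sum_kungWeight_mul_succ (u : K) {m N : ℕ} (hN : m ≤ N) (g : ℕ → K) :
    ∑ A ∈ partMultisets (m + 1), kungWeight u (N + 1) A * g A.card
      = ∑ s ∈ Finset.range (m + 1), g (s + 1) * u ^ ((s + 1) * (s + 1)) *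
          ∑ B ∈ partMultisets (m - s) with B.card ≤ s + 1,
            kungWeight u N B * (qPoch u (s + 1 - B.card))⁻¹ := by
  rw [sum_partMultisets_succ]
  refine Finset.sum_congr rfl fun s _ => ?_
  rw [Finset.mul_sum]
  refine Finset.sum_congr rfl fun B hB => ?_
  obtain ⟨hB, hc⟩ := Finset.mem_filter.1 hB
  obtain ⟨hpos, hsum⟩ := mem_partMultisets.1 hB
  rw [card_addColumn hc, kungWeight_addColumn u (fun x hx => ⟨hpos x hx, ?_⟩) hc]
  · ring
  · have := Multiset.le_sum_of_mem hx
    omega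

theorem sum_kungWeight_mul_inv_qPoch {u : K} (hu : ∀ k, u ^ (k + 1) ≠ 1) (m N t : ℕ) (hN : m ≤ N) :
    ∑ B ∈ partMultisets m with B.card ≤ t + 1, kungWeight u N B * (qPoch u (t + 1 - B.card))⁻¹
      = u ^ m * gaussBinom u (m + t) t * (qPoch u (t + 1))⁻¹ := by
  induction m using Nat.strong_induction_on generalizing N t with
  | _ m ih =>
  rcases m with _ | m
  · have h0 : partMultisets 0 = {0} := by
      ext A
      rw [mem_partMultisets, Finset.mem_singleton]
      constructor
      · rintro ⟨h1, h2⟩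
        have := card_le_sum_of_pos h1
        rw [h2] at this
        exact Multiset.card_eq_zero.1 (by omega)
      · rintro rfl
        simp
    rw [h0, Finset.filter_singleton]
    simp [kungWeight, gaussBinom_self, qPoch_zero]
  · obtain ⟨N, rfl⟩ : ∃ j, N = j + 1 := ⟨N - 1, by omega⟩
    have h1 := sum_kungWeight_mul_succ u (show m ≤ N by omega)
      (fun k => if k ≤ t + 1 then (qPoch u (t + 1 - k))⁻¹ else 0)
    simp only [mul_ite, mul_zero, ← Finset.sum_filter] at h1
    rw [h1]
    have h2 := sum_gaussBinom_mul u (gaussBinom u) (gaussBinom_succ_succ u) m 1 (t + 1)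
    rw [show t + 1 + m = 1 + m + t by omega, gaussBinom_symm hu, add_comm 1 m] at h2
    rw [← h2, Finset.mul_sum, Finset.sum_mul]
    refine Finset.sum_congr rfl fun s hs => ?_
    rw [Finset.mem_range] at hs
    rw [ih (m - s) (by omega) N s (by omega), Nat.sub_add_cancel (by omega)]
    have hp : u ^ ((s + 1) * (s + 1)) * u ^ (m - s) = u ^ (m + 1) * u ^ (s * (s + 1)) := by
      rw [← pow_add, ← pow_add]
      congr 1
      zify [show s ≤ m by omega]
      ring
    split_ifs with hst
    · obtain ⟨r, rfl⟩ : ∃ r, t = s + r := ⟨t - s, by omega⟩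
      have h3 := gaussBinom_add_mul_qPoch u (s + 1) r
      rw [show s + 1 + r = s + r + 1 by omega] at h3
      rw [show s + r + 1 - (s + 1) = r by omega]
      have n1 := qPoch_ne_zero hu (s + 1)
      have n2 := qPoch_ne_zero hu r
      have n3 := qPoch_ne_zero hu (s + r + 1)
      field_simp
      linear_combination (gaussBinom u m s * qPoch u (s + r + 1)) * hp
        - (u ^ (m + 1) * u ^ (s * (s + 1)) * gaussBinom u m s) * h3
    · rw [gaussBinom_eq_zero_of_lt u (show t + 1 < s + 1 by omega)]
      simp

theorem sum_kungWeight {u : K} (hu : ∀ k, u ^ (k + 1) ≠ 1) (n : ℕ) :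
    ∑ A ∈ partMultisets (n + 1), kungWeight u (n + 1) A = u ^ (n + 1) * (qPoch u (n + 1))⁻¹ := by
  have h1 := sum_kungWeight_mul_succ u (le_refl n) fun _ => 1
  simp only [mul_one, one_mul] at h1
  have h2 := sum_gaussBinom_mul u (fun _ k => (qPoch u k)⁻¹) (fun _ k => by
    have n1 := qPoch_ne_zero hu (k + 1)
    have n2 := qPoch_ne_zero hu k
    field_simp
    rw [qPoch_succ]
    ring) n 1 0
  rw [h1, add_comm n 1, ← h2, Finset.mul_sum, add_comm 1 n]
  refine Finset.sum_congr rfl fun s hs => ?_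
  rw [Finset.mem_range] at hs
  rw [sum_kungWeight_mul_inv_qPoch hu (n - s) n s (by omega), Nat.sub_add_cancel (by omega)]
  have hp : u ^ ((s + 1) * (s + 1)) * u ^ (n - s) = u ^ (n + 1) * u ^ (s * (s + 1)) := by
    rw [← pow_add, ← pow_add]
    congr 1
    zify [show s ≤ n by omega]
    ring
  linear_combination (gaussBinom u n s * (qPoch u (s + 1))⁻¹) * hp

end Weight

section Kung

theorem columnCells_eq_sum_count {n : ℕ} {A : Multiset ℕ} (hA : ∀ x ∈ A, 0 < x ∧ x ≤ n) {i : ℕ}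
    (hi : i ≤ n) :
    columnCells A i = (∑ j ∈ Finset.Icc 1 i, j * A.count j)
      + i * ∑ j ∈ Finset.Icc (i + 1) n, A.count j := by
  have h1 : columnCells A i = ∑ j ∈ Finset.Icc 1 n, A.count j * min j i := by
    rw [columnCells, Finset.sum_multiset_map_count]
    simp only [smul_eq_mul]
    refine Finset.sum_subset (fun x hx => Finset.mem_Icc.2 (hA x (Multiset.mem_toFinset.1 hx))) ?_
    intro x _ hx
    rw [Multiset.mem_toFinset] at hx
    rw [Multiset.count_eq_zero_of_notMem hx, zero_mul]
  have h2 : Finset.Icc 1 n = Finset.Icc 1 i ∪ Finset.Icc (i + 1) n := by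
    ext x
    simp only [Finset.mem_union, Finset.mem_Icc]
    omega
  have h3 : Disjoint (Finset.Icc 1 i) (Finset.Icc (i + 1) n) := by
    rw [Finset.disjoint_left]
    intro x
    simp only [Finset.mem_Icc]
    omega
  rw [h1, h2, Finset.sum_union h3, Finset.mul_sum]
  congr 1
  · refine Finset.sum_congr rfl fun j hj => ?_
    rw [min_eq_left (Finset.mem_Icc.1 hj).2, mul_comm]
  · refine Finset.sum_congr rfl fun j hj => ?_
    rw [min_eq_right (by have := (Finset.mem_Icc.1 hj).1; omega), mul_comm]

theorem count_le_columnCells (A : Multiset ℕ) {i : ℕ} (hi : 1 ≤ i) :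
    A.count i ≤ columnCells A i := by
  by_cases h : i ∈ A
  · rw [columnCells, Finset.sum_multiset_map_count]
    refine le_trans ?_ (Finset.single_le_sum (f := fun x => A.count x • min x i)
      (fun _ _ => Nat.zero_le _) (Multiset.mem_toFinset.2 h))
    simpa using Nat.le_mul_of_pos_right _ hi
  · simp [Multiset.count_eq_zero_of_notMem h]

theorem prod_pow_sub_pow {q : ℕ} (hq : 1 ≤ q) {d b : ℕ} (hb : b ≤ d) :
    ((∏ k ∈ Finset.Icc 1 b, (q ^ d - q ^ (d - k)) : ℕ) : ℚ)
      = (q : ℚ) ^ (d * b) * qPoch ((q : ℚ)⁻¹) b := by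
  have hq0 : (q : ℚ) ≠ 0 := by exact_mod_cast (show q ≠ 0 by omega)
  rw [← Finset.Ico_add_one_right_eq_Icc, Finset.prod_Ico_eq_prod_range, Nat.cast_prod, qPoch,
    pow_mul, Nat.add_sub_cancel]
  rw [show ((q : ℚ) ^ d) ^ b = ∏ _k ∈ Finset.range b, (q : ℚ) ^ d by simp,
    ← Finset.prod_mul_distrib]
  refine Finset.prod_congr rfl fun k hk => ?_
  rw [Finset.mem_range] at hk
  rw [Nat.cast_sub (Nat.pow_le_pow_right hq (by omega)), Nat.cast_pow, Nat.cast_pow,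
    add_comm 1 k, pow_sub₀ _ hq0 (by omega), inv_pow]
  ring

theorem cast_gam {q : ℕ} (hq : 1 ≤ q) (n : ℕ) :
    (gam q n : ℚ) = (q : ℚ) ^ (n * n) * qPoch ((q : ℚ)⁻¹) n := by
  rw [← prod_pow_sub_pow hq le_rfl, gam, ← Finset.prod_range_reflect,
    ← Finset.Ico_add_one_right_eq_Icc, Finset.prod_Ico_eq_prod_range, Nat.add_sub_cancel]
  congr 1
  refine Finset.prod_congr rfl fun k _ => ?_
  rw [show n - 1 - k = n - (1 + k) by omega]

end Kung

theorem sum_inv_centralizer_orders (q n : ℕ) (hq : IsPrimePow q) (hn : 1 ≤ n)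
    (b : n.Partition → ℕ → ℕ)
    (hb : ∀ lam i, b lam i = Multiset.count i lam.parts)
    (d : n.Partition → ℕ → ℕ)
    (hd : ∀ lam i, d lam i =
      (∑ j ∈ Finset.Icc 1 i, j * b lam j) + i * ∑ j ∈ Finset.Icc (i + 1) n, b lam j)
    (c : n.Partition → ℕ)
    (hc : ∀ lam, c lam =
      ∏ i ∈ Finset.Icc 1 n, ∏ k ∈ Finset.Icc 1 (b lam i),
        (q ^ (d lam i) - q ^ (d lam i - k))) :
    (∑ lam : n.Partition, (1 : ℚ) / (c lam : ℚ))
        = 1 / ((q : ℚ) ^ n * ∏ i ∈ Finset.Icc 1 n, (1 - ((q : ℚ))⁻¹ ^ i)) ∧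
      (gam q n : ℚ) * (∑ lam : n.Partition, (1 : ℚ) / (c lam : ℚ))
        = (q : ℚ) ^ (n * (n - 1)) := by
  have hq2 : 2 ≤ q := hq.two_le
  have hq0 : (q : ℚ) ≠ 0 := by exact_mod_cast (show q ≠ 0 by omega)
  have hu : ∀ k, ((q : ℚ)⁻¹) ^ (k + 1) ≠ 1 := fun k =>
    (pow_lt_one₀ (by positivity) (inv_lt_one_of_one_lt₀ (by exact_mod_cast hq2)) (by omega)).ne
  have hweight : ∀ lam : n.Partition, (1 : ℚ) / (c lam : ℚ) = kungWeight ((q : ℚ)⁻¹) n lam.parts := by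
    intro lam
    have hmem : ∀ x ∈ lam.parts, 0 < x ∧ x ≤ n := fun x hx =>
      ⟨lam.parts_pos hx, (Multiset.le_sum_of_mem hx).trans_eq lam.parts_sum⟩
    have hdi : ∀ i ≤ n, d lam i = columnCells lam.parts i := by
      intro i hi
      rw [hd, columnCells_eq_sum_count hmem hi]
      simp only [hb]
    rw [hc, Nat.cast_prod, one_div, ← Finset.prod_inv_distrib, kungWeight,
      ← Finset.Ico_add_one_right_eq_Icc, Finset.prod_Ico_eq_prod_range, Nat.add_sub_cancel]
    refine Finset.prod_congr rfl fun i hi => ?_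
    rw [Finset.mem_range] at hi
    rw [hb, add_comm 1 i, hdi _ (by omega),
      prod_pow_sub_pow (by omega) (count_le_columnCells _ (by omega)), mul_inv, inv_pow,
      div_eq_mul_inv]
  have hprod : ∏ i ∈ Finset.Icc 1 n, (1 - ((q : ℚ))⁻¹ ^ i) = qPoch ((q : ℚ)⁻¹) n := by
    rw [← Finset.Ico_add_one_right_eq_Icc, Finset.prod_Ico_eq_prod_range, Nat.add_sub_cancel, qPoch]
    simp only [add_comm]
  have hsum : ∑ lam : n.Partition, (1 : ℚ) / (c lam : ℚ)
      = ((q : ℚ)⁻¹) ^ n * (qPoch ((q : ℚ)⁻¹) n)⁻¹ := by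
    obtain ⟨m, rfl⟩ : ∃ m, n = m + 1 := ⟨n - 1, by omega⟩
    simp only [hweight]
    rw [sum_partition_eq_sum_partMultisets, sum_kungWeight hu]
  have hP := qPoch_ne_zero hu n
  refine ⟨?_, ?_⟩
  · rw [hsum, hprod, one_div, mul_inv, inv_pow]
  · rw [hsum, cast_gam (by omega), Nat.mul_sub, mul_one, pow_sub₀ _ hq0 (Nat.le_mul_self n), inv_pow]
    generalize qPoch ((q : ℚ)⁻¹) n = P at hP ⊢
    field_simp
end

section
/- The number a_n of conjugacy classes of n×n matrices over 𝔽_q (under conjugation by invertible matrices) equals Σ_{λ ⊢ n} q^{ℓ(λ)}, the sum over all partitions λ of n of q raised to the number of parts of λ. (This is the coefficient form of the generating function identity 1 + Σ_{n≥1} a_n u^n = ∏_{r≥1} (1 − q u^r)^{−1}.) -/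
open Polynomial

section
variable {F : Type} [Field F]

theorem conj_iff_nonempty_aeval_linearEquiv {n : ℕ} (A B : Matrix (Fin n) (Fin n) F) :
    (∃ P : Matrix (Fin n) (Fin n) F, IsUnit P ∧ B = P * A * P⁻¹) ↔
      Nonempty (Module.AEval' A.toLin' ≃ₗ[F[X]] Module.AEval' B.toLin') := by
  constructor
  · rintro ⟨P, hP, rfl⟩
    have hP' := (Matrix.isUnit_iff_isUnit_det P).1 hP
    refine ⟨LinearEquiv.ofAEval _
      ((Matrix.toLin'OfInv (Matrix.nonsing_inv_mul P hP') (Matrix.mul_nonsing_inv P hP')).trans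
        (Module.AEval'.of _)) fun m => ?_⟩
    simp only [LinearEquiv.trans_apply, Module.AEval'.X_smul_of]
    congr 1
    simp [Matrix.toLin'OfInv, Matrix.mul_assoc, Matrix.nonsing_inv_mul P hP']
  · rintro ⟨e⟩
    let f : (Fin n → F) ≃ₗ[F] (Fin n → F) :=
      ((Module.AEval'.of A.toLin').trans (e.restrictScalars F)).trans
        (Module.AEval'.of B.toLin').symm
    have hf : f.toLinearMap ∘ₗ A.toLin' = B.toLin' ∘ₗ f.toLinearMap := by
      ext1 v
      ext1
      simp only [LinearMap.comp_apply, f, LinearEquiv.coe_coe, LinearEquiv.trans_apply,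
        LinearEquiv.restrictScalars_apply, ← Module.AEval'.X_smul_of, map_smul,
        Module.AEval'.of_symm_X_smul]
    have hPA : LinearMap.toMatrix' f.toLinearMap * A = B * LinearMap.toMatrix' f.toLinearMap := by
      simpa [LinearMap.toMatrix'_comp] using congrArg LinearMap.toMatrix' hf
    have h1 : LinearMap.toMatrix' f.toLinearMap * LinearMap.toMatrix' f.symm.toLinearMap = 1 := by
      rw [← LinearMap.toMatrix'_comp]; simp
    have hu : IsUnit (LinearMap.toMatrix' f.toLinearMap) := by
      rw [Matrix.isUnit_iff_isUnit_det]
      exact Matrix.isUnit_det_of_right_inverse h1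
    refine ⟨_, hu, ?_⟩
    rw [hPA, Matrix.mul_assoc, Matrix.mul_nonsing_inv _ ((Matrix.isUnit_iff_isUnit_det _).1 hu),
      Matrix.mul_one]

/-- `M` is a direct sum of cyclic modules `F[X] ⧸ (p ^ e)`, with `(p, e)` running over `S`. -/
def HasElementaryDivisors (M : Type) [AddCommGroup M] [Module F[X] M]
    (S : Multiset (F[X] × ℕ)) : Prop :=
  ∃ (ι : Type) (_ : Fintype ι) (g : ι → F[X] × ℕ), Finset.univ.val.map g = S ∧
    Nonempty (M ≃ₗ[F[X]] ∀ i, F[X] ⧸ Ideal.span {(g i).1 ^ (g i).2})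

section
variable {M N : Type} [AddCommGroup M] [Module F[X] M] [AddCommGroup N] [Module F[X] N]
  {S T : Multiset (F[X] × ℕ)}

theorem HasElementaryDivisors.congr (e : M ≃ₗ[F[X]] N) (h : HasElementaryDivisors N S) :
    HasElementaryDivisors M S := by
  obtain ⟨ι, _, g, hg, ⟨f⟩⟩ := h
  exact ⟨ι, _, g, hg, ⟨e.trans f⟩⟩

theorem exists_equiv_of_map_univ_eq {α ι κ : Type*} [Fintype ι] [Fintype κ] {g : ι → α} {h : κ → α}
    (hgh : Finset.univ.val.map g = Finset.univ.val.map h) : ∃ e : ι ≃ κ, ∀ i, h (e i) = g i := by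
  classical
  have hc (a : α) : Fintype.card {i // g i = a} = Fintype.card {i // h i = a} := by
    have := congrArg (Multiset.count a) hgh
    rw [Multiset.count_map, Multiset.count_map] at this
    rw [Fintype.card_subtype, Fintype.card_subtype]
    simpa only [Finset.card, Finset.filter_val, eq_comm] using this
  refine ⟨((Equiv.sigmaFiberEquiv g).symm.trans
    (Equiv.sigmaCongrRight fun a => Fintype.equivOfCardEq (hc a))).trans
    (Equiv.sigmaFiberEquiv h), fun i => ?_⟩
  exact (Fintype.equivOfCardEq (hc (g i)) ⟨i, rfl⟩).2

theorem HasElementaryDivisors.nonempty_linearEquiv (hM : HasElementaryDivisors M S)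
    (hN : HasElementaryDivisors N S) : Nonempty (M ≃ₗ[F[X]] N) := by
  obtain ⟨ι, _, g, hg, ⟨f⟩⟩ := hM
  obtain ⟨κ, _, h, hh, ⟨f'⟩⟩ := hN
  obtain ⟨e, he⟩ := exists_equiv_of_map_univ_eq (hg.trans hh.symm)
  exact ⟨(f.trans ((LinearEquiv.piCongrRight fun i =>
    Submodule.quotEquivOfEq _ _ (by rw [he])).trans
    (LinearEquiv.piCongrLeft F[X] (fun k => F[X] ⧸ Ideal.span {(h k).1 ^ (h k).2}) e))).trans
      f'.symm⟩

end

/-- The multisets of elementary divisors `p ^ e` of total degree `n`. -/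
def IsElementaryDivisors (n : ℕ) (S : Multiset (F[X] × ℕ)) : Prop :=
  (∀ x ∈ S, x.1.Monic ∧ Irreducible x.1 ∧ 0 < x.2) ∧ (S.map fun x => x.2 * x.1.natDegree).sum = n

theorem exists_matrix_hasElementaryDivisors {n : ℕ} {S : Multiset (F[X] × ℕ)}
    (hS : IsElementaryDivisors n S) :
    ∃ A : Matrix (Fin n) (Fin n) F, HasElementaryDivisors (Module.AEval' A.toLin') S := by
  obtain ⟨h1, h2⟩ := hS
  induction S using Quot.inductionOn with | _ L
  let g : Fin L.length → F[X] × ℕ := L.get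
  have hg : Finset.univ.val.map g = (L : Multiset (F[X] × ℕ)) := by
    simp [g, Fin.univ_def]
  change ∃ A : Matrix (Fin n) (Fin n) F,
    HasElementaryDivisors (Module.AEval' A.toLin') (L : Multiset (F[X] × ℕ))
  have hmon : ∀ i, ((g i).1 ^ (g i).2).Monic := fun i => (h1 (g i) (List.get_mem L i)).1.pow _
  have : ∀ i, Module.Finite F (F[X] ⧸ Ideal.span {(g i).1 ^ (g i).2}) :=
    fun i => (hmon i).finite_quotient
  let N := ∀ i, F[X] ⧸ Ideal.span {(g i).1 ^ (g i).2}
  have hN : Module.finrank F N = Module.finrank F (Fin n → F) := by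
    rw [Module.finrank_pi_fintype, Module.finrank_fin_fun, ← h2]
    change _ = ((L : Multiset (F[X] × ℕ)).map fun x => x.2 * x.1.natDegree).sum
    rw [← hg, Multiset.map_map]
    simp [finrank_quotient_span_eq_natDegree, Finset.sum]
  let f : (Fin n → F) ≃ₗ[F] N := (LinearEquiv.ofFinrankEq _ _ hN).symm
  let x : N →ₗ[F] N := Algebra.lsmul F F N (X : F[X])
  refine ⟨LinearMap.toMatrix' (f.symm.toLinearMap ∘ₗ x ∘ₗ f.toLinearMap), _, _, g, hg,
    ⟨LinearEquiv.ofAEval _ f fun m => ?_⟩⟩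
  simp [x]

/-- Trivial factors can be dropped from a product of modules. -/
theorem nonempty_linearEquiv_pi_subtype {ι : Type} {N : ι → Type} [∀ i, AddCommGroup (N i)]
    [∀ i, Module F[X] (N i)] (P : ι → Prop) (hP : ∀ i, ¬ P i → Subsingleton (N i)) :
    Nonempty ((∀ i, N i) ≃ₗ[F[X]] ∀ i : {i // P i}, N i) := by
  classical
  refine ⟨LinearEquiv.ofBijective (LinearMap.pi fun i => LinearMap.proj i.1) ⟨fun x y h => ?_,
    fun y => ⟨fun i => if h : P i then y ⟨i, h⟩ else 0, ?_⟩⟩⟩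
  · funext i
    by_cases hi : P i
    · exact congrFun h ⟨i, hi⟩
    · have := hP i hi
      exact Subsingleton.elim _ _
  · funext i
    simp [i.2]

theorem exists_hasElementaryDivisors {n : ℕ} (A : Matrix (Fin n) (Fin n) F) :
    ∃ S : Multiset (F[X] × ℕ), IsElementaryDivisors n S ∧
      HasElementaryDivisors (Module.AEval' A.toLin') S := by
  obtain ⟨ι, _, p, hp, e, ⟨f⟩⟩ := Module.equiv_directSum_of_isTorsion
    (Module.AEval.isTorsion_of_finiteDimensional F (Fin n → F) A.toLin')
  classical
  have hmon : ∀ i, (normalize (p i)).Monic := fun i => monic_normalize (hp i).ne_zero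
  have hirr : ∀ i, Irreducible (normalize (p i)) := fun i =>
    (normalize_associated (p i)).symm.irreducible (hp i)
  let g : {i // 0 < e i} → F[X] × ℕ := fun i => (normalize (p i), e i)
  obtain ⟨f₂⟩ := nonempty_linearEquiv_pi_subtype (F := F)
    (N := fun i => F[X] ⧸ Ideal.span {p i ^ e i}) (fun i => 0 < e i) (fun i hi => by
      rw [Nat.pos_iff_ne_zero, not_not] at hi
      rw [hi, pow_zero, Ideal.span_singleton_one]
      exact Ideal.Quotient.subsingleton_iff.2 rfl)
  have F₁ : Module.AEval' A.toLin' ≃ₗ[F[X]] ∀ i, F[X] ⧸ Ideal.span {(g i).1 ^ (g i).2} :=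
    (f.trans ((DirectSum.linearEquivFunOnFintype F[X] ι _).trans f₂)).trans
      (LinearEquiv.piCongrRight fun i => Submodule.quotEquivOfEq _ _
        (Ideal.span_singleton_eq_span_singleton.2
          ((normalize_associated (p i)).symm.pow_pow)))
  have : ∀ i, Module.Finite F (F[X] ⧸ Ideal.span {(g i).1 ^ (g i).2}) :=
    fun i => ((hmon i).pow _).finite_quotient
  refine ⟨Finset.univ.val.map g, ⟨?_, ?_⟩, _, _, g, rfl, ⟨F₁⟩⟩
  · intro x hx
    obtain ⟨i, -, rfl⟩ := Multiset.mem_map.1 hx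
    exact ⟨hmon i, hirr i, i.2⟩
  · have h := ((Module.AEval'.of A.toLin').trans (F₁.restrictScalars F)).finrank_eq
    rw [Module.finrank_fin_fun, Module.finrank_pi_fintype] at h
    rw [h, Multiset.map_map]
    simp [finrank_quotient_span_eq_natDegree]

/-- The dimension over `F` of `p ^ k • (F[X] ⧸ (r ^ e))`, where `x = (r, e)`. -/
noncomputable def powSMulDim (p : F[X]) (k : ℕ) (x : F[X] × ℕ) : ℕ :=
  open Classical in (if x.1 = p then x.2 - k else x.2) * x.1.natDegree

open Classical in
theorem sum_powSMulDim_succ (p : F[X]) (k : ℕ) (S : Multiset (F[X] × ℕ)) :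
    (S.map (powSMulDim p k)).sum = (S.map (powSMulDim p (k + 1))).sum +
      S.countP (fun x => x.1 = p ∧ k < x.2) * p.natDegree := by
  induction S using Multiset.induction with
  | empty => simp
  | cons x S ih =>
    have : powSMulDim p k x = powSMulDim p (k + 1) x +
        (if x.1 = p ∧ k < x.2 then 1 else 0) * p.natDegree := by
      unfold powSMulDim
      by_cases h : x.1 = p
      · by_cases h' : k < x.2
        · simp only [h, h', and_self, if_true]
          rw [← add_mul]
          congr 1
          omega
        · simp [h, h', Nat.sub_eq_zero_of_le (not_lt.1 h'),
            Nat.sub_eq_zero_of_le ((not_lt.1 h').trans k.le_succ)]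
      · simp [h]
    simp only [Multiset.map_cons, Multiset.sum_cons, Multiset.countP_cons, ih, this]
    ring

open Classical in
theorem countP_lt_eq (S : Multiset (F[X] × ℕ)) (p : F[X]) (k : ℕ) :
    S.countP (fun x => x.1 = p ∧ k < x.2) =
      S.countP (fun x => x.1 = p ∧ k + 1 < x.2) + S.count (p, k + 1) := by
  induction S using Multiset.induction with
  | empty => simp
  | cons x S ih =>
    obtain ⟨r, e⟩ := x
    simp only [Multiset.countP_cons, Multiset.count_cons, ih, Prod.mk.injEq]
    split_ifs <;> grind

section
open UniqueFactorizationMonoid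

/-- Tag each member of the `k`-th multiset with the exponent `k + 1`, and collect everything. -/
def tagged {α : Type*} {n : ℕ} (T : Fin n → Multiset α) : Multiset (α × ℕ) :=
  Finset.univ.val.bind fun k => (T k).map fun a => (a, (k : ℕ) + 1)

theorem count_tagged {α : Type*} [DecidableEq α] {n : ℕ} (T : Fin n → Multiset α) (a : α) (j : Fin n) :
    (tagged T).count (a, (j : ℕ) + 1) = (T j).count a := by
  have h (k : Fin n) : ((T k).map fun b => (b, (k : ℕ) + 1)).count (a, (j : ℕ) + 1) =
      if k = j then (T j).count a else 0 := by
    split_ifs with hk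
    · subst hk
      exact Multiset.count_map_eq_count' (fun b => (b, (k : ℕ) + 1)) _
        (fun _ _ h => (Prod.mk.inj h).1) a
    · refine Multiset.count_eq_zero_of_notMem fun hm => hk ?_
      obtain ⟨b, -, hb⟩ := Multiset.mem_map.1 hm
      exact Fin.ext (Nat.succ_injective (Prod.mk.inj hb).2)
  rw [tagged, Multiset.count_bind]
  simp only [h]
  rw [← Finset.sum_eq_multiset_sum, Finset.sum_ite_eq' _ j, if_pos (Finset.mem_univ _)]

theorem tagged_filter {α : Type*} {n : ℕ} (S : Multiset (α × ℕ))
    (hS : ∀ x ∈ S, 0 < x.2 ∧ x.2 ≤ n) :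
    tagged (fun k : Fin n => (S.filter fun x => x.2 = (k : ℕ) + 1).map Prod.fst) = S := by
  have h (k : Fin n) : ((S.filter fun x => x.2 = (k : ℕ) + 1).map Prod.fst).map
      (fun a => (a, (k : ℕ) + 1)) = S.filter fun x => x.2 = (k : ℕ) + 1 := by
    rw [Multiset.map_map]
    conv_rhs => rw [← Multiset.map_id (S.filter _)]
    exact Multiset.map_congr rfl fun x hx => Prod.ext rfl (Multiset.mem_filter.1 hx).2.symm
  classical
  ext x
  rw [tagged, Multiset.count_bind]
  simp only [h, Multiset.count_filter]
  by_cases hx : x ∈ S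
  · obtain ⟨h0, hn⟩ := hS x hx
    rw [← Finset.sum_eq_multiset_sum, Finset.sum_eq_single ⟨x.2 - 1, by omega⟩]
    · simp [Nat.sub_add_cancel h0]
    · intro k _ hk
      rw [if_neg fun hk' => hk (Fin.ext (by simp [hk']))]
    · simp
  · simp [Multiset.count_eq_zero_of_notMem hx]

theorem sum_tagged {α : Type*} {n : ℕ} (T : Fin n → Multiset α) (d : α → ℕ) :
    ((tagged T).map fun x => x.2 * d x.1).sum = ∑ k : Fin n, ((k : ℕ) + 1) * ((T k).map d).sum := by
  rw [tagged, Multiset.map_bind, Multiset.sum_bind, Finset.sum_eq_multiset_sum]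
  simp [Multiset.map_map, Multiset.sum_map_mul_left]

variable [DecidableEq F]

theorem Polynomial.Monic.prod_normalizedFactors {f : F[X]} (hf : f.Monic) :
    (normalizedFactors f).prod = f := by
  rw [prod_normalizedFactors_eq hf.ne_zero, hf.normalize_eq_self]

theorem Polynomial.monic_of_mem_normalizedFactors {f p : F[X]} (hp : p ∈ normalizedFactors f) :
    p.Monic := by
  rw [← normalize_normalized_factor p hp]
  exact monic_normalize (irreducible_of_normalized_factor p hp).ne_zero

theorem normalizedFactors_prod_of_monic {s : Multiset F[X]}
    (hs : ∀ p ∈ s, p.Monic ∧ Irreducible p) : normalizedFactors s.prod = s := by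
  rw [normalizedFactors_prod_eq s fun p hp => (hs p hp).2]
  conv_rhs => rw [← Multiset.map_id s]
  exact Multiset.map_congr rfl fun p hp => (hs p hp).1.normalize_eq_self

theorem Polynomial.Monic.sum_natDegree_normalizedFactors {f : F[X]} (hf : f.Monic) :
    ((normalizedFactors f).map natDegree).sum = f.natDegree := by
  conv_rhs => rw [← hf.prod_normalizedFactors]
  rw [natDegree_multiset_prod_of_monic _ fun p hp => monic_of_mem_normalizedFactors hp]

theorem card_elementaryDivisors_eq_card_monic (n : ℕ) :
    Nat.card {S : Multiset (F[X] × ℕ) // IsElementaryDivisors n S} =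
      Nat.card {f : Fin n → F[X] //
        (∀ k, (f k).Monic) ∧ ∑ k : Fin n, ((k : ℕ) + 1) * (f k).natDegree = n} := by
  symm
  refine Nat.card_eq_of_bijective
    (fun f => ⟨tagged fun k => normalizedFactors (f.1 k), ?_, ?_⟩) ⟨?_, ?_⟩
  · intro x hx
    obtain ⟨k, -, hk⟩ := Multiset.mem_bind.1 hx
    obtain ⟨p, hp, rfl⟩ := Multiset.mem_map.1 hk
    exact ⟨monic_of_mem_normalizedFactors hp, irreducible_of_normalized_factor p hp,
      Nat.succ_pos _⟩
  · rw [sum_tagged]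
    simpa only [(f.2.1 _).sum_natDegree_normalizedFactors] using f.2.2
  · intro f g hfg
    refine Subtype.ext (funext fun j => ?_)
    rw [← (f.2.1 j).prod_normalizedFactors, ← (g.2.1 j).prod_normalizedFactors]
    congr 1
    ext p
    have := congrArg (Multiset.count (p, (j : ℕ) + 1)) (congrArg Subtype.val hfg)
    simpa only [count_tagged] using this
  · rintro ⟨S, hS, hn⟩
    let T : Fin n → Multiset F[X] :=
      fun k => (S.filter fun x => x.2 = (k : ℕ) + 1).map Prod.fst
    have hT : ∀ k, ∀ p ∈ T k, p.Monic ∧ Irreducible p := by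
      intro k p hp
      obtain ⟨x, hx, rfl⟩ := Multiset.mem_map.1 hp
      have := hS x (Multiset.mem_of_mem_filter hx)
      exact ⟨this.1, this.2.1⟩
    have hTS : tagged T = S := tagged_filter S fun x hx => by
      refine ⟨(hS x hx).2.2, ?_⟩
      calc x.2 ≤ x.2 * x.1.natDegree := Nat.le_mul_of_pos_right _ (hS x hx).2.1.natDegree_pos
        _ ≤ _ := Multiset.single_le_sum (fun _ _ => Nat.zero_le _) _
          (Multiset.mem_map_of_mem (fun x : F[X] × ℕ => x.2 * x.1.natDegree) hx)
        _ = n := hn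
    have hm : ∀ k, (T k).prod.Monic := fun k =>
      by simpa using monic_multiset_prod_of_monic (T k) id fun p hp => (hT k p hp).1
    refine ⟨⟨fun k => (T k).prod, hm, ?_⟩, Subtype.ext ?_⟩
    · rw [← hTS, sum_tagged] at hn
      refine Eq.trans ?_ hn
      exact Finset.sum_congr rfl fun k _ => by
        rw [natDegree_multiset_prod_of_monic _ fun p hp => (hT k p hp).1]
    · simp only [normalizedFactors_prod_of_monic (hT _), hTS]

end

/-- Multiplicities `m k` of the parts `k + 1` give a partition of `n`. -/
def partitionOfMultiplicities {n : ℕ} (m : Fin n → ℕ) (hm : ∑ k : Fin n, ((k : ℕ) + 1) * m k = n) :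
    n.Partition where
  parts := Finset.univ.val.bind fun k => Multiset.replicate (m k) ((k : ℕ) + 1)
  parts_pos := by
    intro i hi
    obtain ⟨k, -, hk⟩ := Multiset.mem_bind.1 hi
    rw [Multiset.eq_of_mem_replicate hk]
    exact Nat.succ_pos _
  parts_sum := by
    rw [Multiset.sum_bind, ← Finset.sum_eq_multiset_sum]
    simpa [mul_comm] using hm

theorem count_partitionOfMultiplicities {n : ℕ} (m : Fin n → ℕ)
    (hm : ∑ k : Fin n, ((k : ℕ) + 1) * m k = n) (j : Fin n) :
    (partitionOfMultiplicities m hm).parts.count ((j : ℕ) + 1) = m j := by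
  rw [partitionOfMultiplicities, Multiset.count_bind, ← Finset.sum_eq_multiset_sum]
  simp [Multiset.count_replicate, Fin.val_inj]

theorem Nat.Partition.parts_eq_of_count {n : ℕ} {lam mu : n.Partition}
    (h : ∀ j : Fin n, lam.parts.count ((j : ℕ) + 1) = mu.parts.count ((j : ℕ) + 1)) :
    lam = mu := by
  ext i
  by_cases hi : 0 < i ∧ i ≤ n
  · have := h ⟨i - 1, by omega⟩
    simpa [Nat.sub_add_cancel hi.1] using this
  · rw [Multiset.count_eq_zero_of_notMem fun hm => hi ⟨lam.parts_pos hm, lam.le_of_mem_parts hm⟩,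
      Multiset.count_eq_zero_of_notMem fun hm => hi ⟨mu.parts_pos hm, mu.le_of_mem_parts hm⟩]

theorem Nat.Partition.sum_fin_succ {n : ℕ} (lam : n.Partition) (w : ℕ → ℕ) :
    ∑ k : Fin n, lam.parts.count ((k : ℕ) + 1) * w ((k : ℕ) + 1) = (lam.parts.map w).sum := by
  rw [Finset.sum_multiset_map_count, Fin.sum_univ_eq_sum_range
    (fun k => lam.parts.count (k + 1) * w (k + 1)),
    Finset.range_eq_Ico, Finset.sum_Ico_add' (fun i => lam.parts.count i * w i)]
  symm
  refine Finset.sum_subset (fun i hi => ?_) fun i _ hi => ?_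
  · rw [Multiset.mem_toFinset] at hi
    have := lam.parts_pos hi
    have := lam.le_of_mem_parts hi
    simp
    omega
  · rw [Multiset.count_eq_zero_of_notMem fun h => hi (Multiset.mem_toFinset.2 h)]
    simp

variable [Fintype F]

theorem card_quotient_span {h : F[X]} (hh : h.Monic) :
    Nat.card (F[X] ⧸ Ideal.span {h}) = Fintype.card F ^ h.natDegree := by
  have := hh.finite_quotient
  rw [Module.natCard_eq_pow_finrank (K := F), finrank_quotient_span_eq_natDegree,
    Nat.card_eq_fintype_card]

theorem card_range_smul_quotient_span (g : F[X]) {h h' : F[X]} (hh' : h'.Monic)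
    (H : ∀ y, h ∣ y * g ↔ h' ∣ y) :
    Nat.card (Set.range fun x : F[X] ⧸ Ideal.span {h} => g • x) =
      Fintype.card F ^ h'.natDegree := by
  have h1 : (Set.range fun x : F[X] ⧸ Ideal.span {h} => g • x) =
      ↑(Submodule.span F[X] {Ideal.Quotient.mk (Ideal.span {h}) g}) := by
    ext z
    simp only [Set.mem_range, SetLike.mem_coe, Submodule.mem_span_singleton]
    constructor
    · rintro ⟨x, rfl⟩
      obtain ⟨y, rfl⟩ := Ideal.Quotient.mk_surjective x
      exact ⟨y, congrArg (Ideal.Quotient.mk _) (mul_comm y g)⟩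
    · rintro ⟨y, rfl⟩
      exact ⟨Ideal.Quotient.mk _ y, congrArg (Ideal.Quotient.mk _) (mul_comm g y)⟩
  have h2 : Ideal.torsionOf F[X] _ (Ideal.Quotient.mk (Ideal.span {h}) g) = Ideal.span {h'} := by
    ext y
    rw [Ideal.mem_torsionOf_iff, Ideal.mem_span_singleton, ← H, ← Ideal.mem_span_singleton,
      ← Ideal.Quotient.eq_zero_iff_mem, map_mul]
    rfl
  rw [h1, ← card_quotient_span hh', ← h2]
  exact Nat.card_congr (Ideal.quotTorsionOfEquivSpanSingleton F[X] _ _).symm.toEquiv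

theorem card_range_pow_smul_quotient {p r : F[X]} (hp : p.Monic) (hp' : Irreducible p)
    (hr : r.Monic) (hr' : Irreducible r) (k e : ℕ) :
    Nat.card (Set.range fun x : F[X] ⧸ Ideal.span {r ^ e} => p ^ k • x) =
      Fintype.card F ^ powSMulDim p k (r, e) := by
  unfold powSMulDim
  split_ifs with h
  · obtain rfl : r = p := h
    rw [← hr.natDegree_pow]
    refine card_range_smul_quotient_span _ (hr.pow _) fun y => ?_
    obtain hke | hke := le_total k e
    · conv_lhs => rw [← Nat.sub_add_cancel hke, pow_add]
      exact mul_dvd_mul_iff_right (pow_ne_zero _ hr.ne_zero)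
    · simp [Nat.sub_eq_zero_of_le hke, (pow_dvd_pow r hke).mul_left]
  · rw [← hr.natDegree_pow]
    refine card_range_smul_quotient_span _ (hr.pow _) fun y => ?_
    have : IsCoprime r p := hr'.coprime_iff_not_dvd.2 fun hd =>
      h (eq_of_monic_of_associated hr hp (hr'.associated_of_dvd hp' hd))
    exact ⟨(this.pow).dvd_of_dvd_mul_right, fun h => h.mul_right _⟩

theorem HasElementaryDivisors.card_range_pow_smul {M : Type} [AddCommGroup M] [Module F[X] M]
    {S : Multiset (F[X] × ℕ)} (hM : HasElementaryDivisors M S)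
    (hS : ∀ x ∈ S, x.1.Monic ∧ Irreducible x.1 ∧ 0 < x.2) {p : F[X]} (hp : p.Monic)
    (hp' : Irreducible p) (k : ℕ) :
    Nat.card (Set.range fun x : M => p ^ k • x) =
      Fintype.card F ^ (S.map (powSMulDim p k)).sum := by
  obtain ⟨ι, _, g, rfl, ⟨f⟩⟩ := hM
  let N : ι → Type := fun i => F[X] ⧸ Ideal.span {(g i).1 ^ (g i).2}
  have h1 : (Set.range fun x : M => p ^ k • x) ≃ (Set.range fun x : (∀ i, N i) => p ^ k • x) :=
    f.toEquiv.subtypeEquiv fun y => by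
      constructor
      · rintro ⟨x, rfl⟩
        exact ⟨f x, (map_smul f _ _).symm⟩
      · rintro ⟨x, hx⟩
        refine ⟨f.symm x, f.injective ?_⟩
        simpa using hx
  have h2 : (Set.range fun x : (∀ i, N i) => p ^ k • x) ≃
      ∀ i, Set.range fun x : N i => p ^ k • x :=
    { toFun := fun x i => ⟨x.1 i, by obtain ⟨y, hy⟩ := x.2; exact ⟨y i, congrFun hy i⟩⟩
      invFun := fun x => ⟨fun i => (x i).1, fun i => (x i).2.choose,
        funext fun i => (x i).2.choose_spec⟩
      left_inv := fun _ => rfl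
      right_inv := fun _ => rfl }
  rw [Nat.card_congr (h1.trans h2), Nat.card_pi, Multiset.map_map, ← Finset.sum_eq_multiset_sum,
    ← Finset.prod_pow_eq_pow_sum]
  refine Finset.prod_congr rfl fun i _ => ?_
  have := hS (g i) (Multiset.mem_map_of_mem g (Finset.mem_univ i))
  exact card_range_pow_smul_quotient hp hp' this.1 this.2.1 k _

theorem HasElementaryDivisors.unique {M : Type} [AddCommGroup M] [Module F[X] M]
    {S T : Multiset (F[X] × ℕ)} (hMS : HasElementaryDivisors M S)
    (hMT : HasElementaryDivisors M T)
    (hS : ∀ x ∈ S, x.1.Monic ∧ Irreducible x.1 ∧ 0 < x.2)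
    (hT : ∀ x ∈ T, x.1.Monic ∧ Irreducible x.1 ∧ 0 < x.2) : S = T := by
  classical
  ext ⟨p, e⟩
  by_cases hpe : p.Monic ∧ Irreducible p ∧ 0 < e
  · obtain ⟨hp, hp', he⟩ := hpe
    obtain ⟨k, rfl⟩ := Nat.exists_eq_succ_of_ne_zero he.ne'
    have h1 (k : ℕ) : (S.map (powSMulDim p k)).sum = (T.map (powSMulDim p k)).sum :=
      Nat.pow_right_injective (Fintype.one_lt_card (α := F))
        ((hMS.card_range_pow_smul hS hp hp' k).symm.trans (hMT.card_range_pow_smul hT hp hp' k))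
    have h2 (k : ℕ) : S.countP (fun x => x.1 = p ∧ k < x.2) =
        T.countP (fun x => x.1 = p ∧ k < x.2) := by
      have h3 := sum_powSMulDim_succ p k S
      rw [h1, h1, sum_powSMulDim_succ p k T] at h3
      exact (Nat.eq_of_mul_eq_mul_right hp'.natDegree_pos (Nat.add_left_cancel h3)).symm
    have h3 := countP_lt_eq S p k
    rw [h2, h2, countP_lt_eq T p k] at h3
    exact (Nat.add_left_cancel h3).symm
  · rw [Multiset.count_eq_zero_of_notMem fun h => hpe (hS _ h),
      Multiset.count_eq_zero_of_notMem fun h => hpe (hT _ h)]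

theorem card_quot_conj_eq_card_elementaryDivisors (n : ℕ) :
    Nat.card (Quot fun A B : Matrix (Fin n) (Fin n) F =>
        ∃ P : Matrix (Fin n) (Fin n) F, IsUnit P ∧ B = P * A * P⁻¹) =
      Nat.card {S : Multiset (F[X] × ℕ) // IsElementaryDivisors n S} := by
  choose s hs hs' using fun A : Matrix (Fin n) (Fin n) F => exists_hasElementaryDivisors A
  refine Nat.card_eq_of_bijective (Quot.lift (fun A => ⟨s A, hs A⟩) ?_) ⟨?_, ?_⟩
  · intro A B hAB
    obtain ⟨e⟩ := (conj_iff_nonempty_aeval_linearEquiv A B).1 hAB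
    exact Subtype.ext ((hs' A).unique ((hs' B).congr e) (hs A).1 (hs B).1)
  · rintro ⟨A⟩ ⟨B⟩ hAB
    have hAB : s A = s B := congrArg Subtype.val hAB
    exact Quot.sound ((conj_iff_nonempty_aeval_linearEquiv A B).2
      ((hs' A).nonempty_linearEquiv (hAB ▸ hs' B)))
  · rintro ⟨S, hS⟩
    obtain ⟨A, hA⟩ := exists_matrix_hasElementaryDivisors hS
    exact ⟨Quot.mk _ A, Subtype.ext ((hs' A).unique hA (hs A).1 hS.1)⟩

theorem card_monic_natDegree_eq (m : ℕ) :
    Nat.card {p : F[X] // p.Monic ∧ p.natDegree = m} = Fintype.card F ^ m := by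
  rw [Nat.card_congr ((monicEquivDegreeLT m).trans (degreeLTEquiv F m).toEquiv),
    Nat.card_eq_fintype_card, Fintype.card_fun, Fintype.card_fin]

theorem card_monic_eq_sum_partition (n : ℕ) :
    Nat.card {f : Fin n → F[X] //
        (∀ k, (f k).Monic) ∧ ∑ k : Fin n, ((k : ℕ) + 1) * (f k).natDegree = n} =
      ∑ lam : n.Partition, Fintype.card F ^ Multiset.card lam.parts := by
  let φ : {f : Fin n → F[X] //
      (∀ k, (f k).Monic) ∧ ∑ k : Fin n, ((k : ℕ) + 1) * (f k).natDegree = n} → n.Partition :=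
    fun f => partitionOfMultiplicities (fun k => (f.1 k).natDegree) f.2.2
  let fib (lam : n.Partition) : {f // φ f = lam} ≃
      ∀ k : Fin n, {p : F[X] // p.Monic ∧ p.natDegree = lam.parts.count ((k : ℕ) + 1)} :=
    { toFun := fun f k => ⟨f.1.1 k, f.1.2.1 k, by
        exact (count_partitionOfMultiplicities _ f.1.2.2 k).symm.trans
          (congrArg (fun mu : n.Partition => mu.parts.count _) f.2)⟩
      invFun := fun g => ⟨⟨fun k => (g k).1, fun k => (g k).2.1, by
          simp only [(g _).2.2]
          simpa [lam.parts_sum, mul_comm] using lam.sum_fin_succ id⟩,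
        Nat.Partition.parts_eq_of_count fun j =>
          (count_partitionOfMultiplicities _ _ j).trans (g j).2.2⟩
      left_inv := fun _ => rfl
      right_inv := fun _ => rfl }
  have (m : ℕ) : Finite {p : F[X] // p.Monic ∧ p.natDegree = m} :=
    Finite.of_equiv _ ((monicEquivDegreeLT m).trans (degreeLTEquiv F m).toEquiv).symm
  rw [Nat.card_congr ((Equiv.sigmaFiberEquiv φ).symm.trans (Equiv.sigmaCongrRight fib)),
    Nat.card_sigma]
  refine Finset.sum_congr rfl fun lam _ => ?_
  rw [Nat.card_pi]
  simp only [card_monic_natDegree_eq]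
  rw [Finset.prod_pow_eq_pow_sum]
  congr 1
  simpa using lam.sum_fin_succ fun _ => 1

end

theorem card_conjClasses_matrices {F : Type} [Field F] [Fintype F] (q : ℕ)
    (hq : Fintype.card F = q) (n : ℕ) :
    Nat.card (Quot fun A B : Matrix (Fin n) (Fin n) F =>
        ∃ P : Matrix (Fin n) (Fin n) F, IsUnit P ∧ B = P * A * P⁻¹)
      = ∑ lam : n.Partition, q ^ Multiset.card lam.parts := by
  classical
  subst hq
  rw [card_quot_conj_eq_card_elementaryDivisors, card_elementaryDivisors_eq_card_monic,
    card_monic_eq_sum_partition]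
end

section
/- Let {n k}_q denote the number of direct sum splittings of 𝔽_q^n into k non-trivial subspaces without regard to order, i.e., the number of k-element sets S of nonzero subspaces of 𝔽_q^n that are independent and whose sum is all of 𝔽_q^n. Then k! · {n k}_q = Σ γ_n/(γ_{n_1}·γ_{n_2}⋯γ_{n_k}), where the sum is over all ordered k-tuples (n_1, …, n_k) of positive integers with n_1 + ⋯ + n_k = n. -/
/-- The number of direct sum splittings of `F^n` into `k` pairwise independent, spanning,
nonzero subspaces, without regard to order: the `q`-Stirling number `{n k}_q`. -/
noncomputable def splittingCount (F : Type) [Field F] [Fintype F] (n k : ℕ) : ℕ :=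
  Nat.card {S : Finset (Submodule F (Fin n → F)) //
    S.card = k ∧ (∀ W ∈ S, W ≠ ⊥) ∧ sSupIndep (S : Set (Submodule F (Fin n → F))) ∧
      sSup (S : Set (Submodule F (Fin n → F))) = ⊤}

open Module

section DirectSumSplittings

variable {F V : Type*} [Field F] [AddCommGroup V] [Module F V]

/-- Over a finite field, a space of dimension `n` has `|GL_n|` bases. -/
theorem card_linearIndependent_eq_gam [Fintype F] [Finite V] {ι : Type*} [Fintype ι]
    (h : Fintype.card ι = finrank F V) :
    Nat.card {v : ι → V // LinearIndependent F v} = gam (Fintype.card F) (Fintype.card ι) := by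
  have e : {v : ι → V // LinearIndependent F v} ≃
      {v : Fin (Fintype.card ι) → V // LinearIndependent F v} :=
    ((Fintype.equivFin ι).arrowCongr (Equiv.refl V)).subtypeEquiv fun v =>
      (linearIndependent_equiv (Fintype.equivFin ι).symm).symm
  rw [Nat.card_congr e, card_linearIndependent h.le, gam, ← h, Finset.prod_range]

theorem gam_pos {q : ℕ} (hq : 1 < q) (n : ℕ) : 0 < gam q n :=
  Finset.prod_pos fun _ hi =>
    Nat.sub_pos_of_lt (Nat.pow_lt_pow_right hq (Finset.mem_range.1 hi))

/-- The spans of the blocks of a linearly independent family are independent. -/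
theorem LinearIndependent.iSupIndep_span_sigma {ι : Type*} {κ : ι → Type*}
    {v : (Σ i, κ i) → V} (hv : LinearIndependent F v) :
    iSupIndep fun i => Submodule.span F (Set.range fun j => v ⟨i, j⟩) := by
  intro i
  have hd : Disjoint (Sigma.fst ⁻¹' {i} : Set (Σ i, κ i)) (Sigma.fst ⁻¹' {i}ᶜ) :=
    disjoint_compl_right.preimage _
  refine (hv.disjoint_span_image hd).mono (Submodule.span_mono ?_)
    (iSup₂_le fun l hl => Submodule.span_mono ?_)
  · rintro _ ⟨j, rfl⟩
    exact ⟨⟨i, j⟩, rfl, rfl⟩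
  · rintro _ ⟨j, rfl⟩
    exact ⟨⟨l, j⟩, hl, rfl⟩

theorem iSup_span_sigma {ι : Type*} {κ : ι → Type*} (v : (Σ i, κ i) → V) :
    ⨆ i, Submodule.span F (Set.range fun j => v ⟨i, j⟩) = Submodule.span F (Set.range v) := by
  rw [← Submodule.span_iUnion, Set.range_sigma_eq_iUnion_range]

variable [FiniteDimensional F V]

/-- Bases of the summands of a direct sum splitting are jointly linearly independent. -/
theorem linearIndependent_sigma_of_splitting {ι : Type*} {κ : ι → Type*}
    [∀ i, Fintype (κ i)] {W : ι → Submodule F V} (hi : iSupIndep W) (ht : ⨆ i, W i = ⊤)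
    (hd : ∀ i, finrank F (W i) = Fintype.card (κ i)) {u : ∀ i, κ i → W i}
    (hu : ∀ i, LinearIndependent F (u i)) :
    LinearIndependent F fun p : Σ i, κ i => (u p.1 p.2 : V) := by
  classical
  have hW := DirectSum.isInternal_submodule_of_iSupIndep_of_iSup_eq_top hi ht
  let b := hW.collectedBasis fun i => Basis.mk (hu i)
    ((hu i).span_eq_top_of_card_eq_finrank' (hd i).symm).ge
  convert b.linearIndependent using 1
  ext p
  simp [b]

theorem span_range_coe_eq {κ : Type*} [Fintype κ] {W : Submodule F V} {u : κ → W}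
    (hu : LinearIndependent F u) (hd : finrank F W = Fintype.card κ) :
    Submodule.span F (Set.range fun j => (u j : V)) = W := by
  have h := congrArg (Submodule.map W.subtype) (hu.span_eq_top_of_card_eq_finrank' hd.symm)
  rwa [Submodule.map_span, ← Set.range_comp, Submodule.map_top, Submodule.range_subtype] at h

/-- Choosing a basis adapted to a splitting with summands of dimensions `c` amounts to choosing
the splitting and then a basis of each summand. -/
theorem card_splittings_mul_prod_gam [Fintype F] {ι : Type*} [Fintype ι] (c : ι → ℕ)
    (hc : ∑ i, c i = finrank F V) :
    Nat.card {W : ι → Submodule F V //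
        (iSupIndep W ∧ ⨆ i, W i = ⊤) ∧ ∀ i, finrank F (W i) = c i} *
      ∏ i, gam (Fintype.card F) (c i) = gam (Fintype.card F) (finrank F V) := by
  classical
  have : Finite V := Module.finite_of_finite F
  let T := {W : ι → Submodule F V //
    (iSupIndep W ∧ ⨆ i, W i = ⊤) ∧ ∀ i, finrank F (W i) = c i}
  let _ : Fintype T := Fintype.ofFinite T
  let f : (Σ W : T, ∀ i, {u : Fin (c i) → W.1 i // LinearIndependent F u}) →
      {v : (Σ i, Fin (c i)) → V // LinearIndependent F v} := fun x =>
    ⟨fun p => ((x.2 p.1).1 p.2 : V), linearIndependent_sigma_of_splitting x.1.2.1.1 x.1.2.1.2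
      (by simpa using x.1.2.2) fun i => (x.2 i).2⟩
  have hcard : Fintype.card (Σ i, Fin (c i)) = finrank F V := by simpa using hc
  have hf : Function.Bijective f := by
    constructor
    · rintro ⟨⟨W, hW⟩, u⟩ ⟨⟨W', hW'⟩, u'⟩ h
      have h' : ∀ i j, ((u i).1 j : V) = ((u' i).1 j : V) := fun i j =>
        congrFun (congrArg Subtype.val h) ⟨i, j⟩
      have hWW : W = W' := by
        funext i
        have hu := span_range_coe_eq (u i).2 (by simpa using hW.2 i)
        simp only [h' i] at hu
        exact hu.symm.trans (span_range_coe_eq (u' i).2 (by simpa using hW'.2 i))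
      subst hWW
      congr 1
      funext i
      exact Subtype.ext (funext fun j => Subtype.ext (h' i j))
    · rintro ⟨v, hv⟩
      have hvi (i : ι) : LinearIndependent F fun j => v ⟨i, j⟩ :=
        hv.comp _ sigma_mk_injective
      refine ⟨⟨⟨fun i => Submodule.span F (Set.range fun j => v ⟨i, j⟩),
        ⟨hv.iSupIndep_span_sigma, ?_⟩, fun i => ?_⟩,
        fun i => ⟨fun j => ⟨v ⟨i, j⟩, Submodule.subset_span ⟨j, rfl⟩⟩, ?_⟩⟩, rfl⟩
      · rw [iSup_span_sigma, hv.span_eq_top_of_card_eq_finrank' hcard]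
      · simpa using finrank_span_eq_card (hvi i)
      · exact LinearIndependent.of_comp (Submodule.subtype _) (hvi i)
  have key := Nat.card_eq_of_bijective f hf
  rw [card_linearIndependent_eq_gam hcard, hcard, Nat.card_sigma] at key
  rw [← key, Finset.sum_congr rfl fun W _ => by
    rw [Nat.card_pi, Finset.prod_congr rfl fun i _ => by
      rw [card_linearIndependent_eq_gam (by simpa using (W.2.2 i).symm), Fintype.card_fin]]]
  simp [T, Nat.card_eq_fintype_card]

theorem sum_finrank_of_splitting {ι : Type*} [Fintype ι] {W : ι → Submodule F V}
    (hi : iSupIndep W) (ht : ⨆ i, W i = ⊤) : ∑ i, finrank F (W i) = finrank F V := by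
  classical
  rw [finrank_eq_card_basis ((DirectSum.isInternal_submodule_of_iSupIndep_of_iSup_eq_top hi
    ht).collectedBasis fun i => finBasis F (W i))]
  simp

end DirectSumSplittings

/-- Each unordered splitting into `k` summands has `k!` orderings. -/
theorem factorial_mul_splittingCount_eq_card {F : Type} [Field F] [Fintype F] (n k : ℕ) :
    k.factorial * splittingCount F n k =
      Nat.card {W : Fin k → Submodule F (Fin n → F) //
        (∀ i, W i ≠ ⊥) ∧ iSupIndep W ∧ ⨆ i, W i = ⊤} := by
  classical
  let T := {S : Finset (Submodule F (Fin n → F)) //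
    S.card = k ∧ (∀ W ∈ S, W ≠ ⊥) ∧ sSupIndep (S : Set (Submodule F (Fin n → F))) ∧
      sSup (S : Set (Submodule F (Fin n → F))) = ⊤}
  let _ : Fintype T := Fintype.ofFinite T
  let f : (Σ S : T, (Fin k ≃ S.1)) → {W : Fin k → Submodule F (Fin n → F) //
      (∀ i, W i ≠ ⊥) ∧ iSupIndep W ∧ ⨆ i, W i = ⊤} := fun x =>
    ⟨fun i => x.2 i, fun i => x.1.2.2.1 _ (x.2 i).2,
      ((sSupIndep_iff _).1 x.1.2.2.2.1).comp x.2.injective, by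
        rw [x.2.iSup_comp (g := fun W : x.1.1 => (W : Submodule F (Fin n → F)))]
        exact (sSup_eq_iSup' _).symm.trans x.1.2.2.2.2⟩
  have hf : Function.Bijective f := by
    constructor
    · rintro ⟨⟨S, hS⟩, e⟩ ⟨⟨S', hS'⟩, e'⟩ h
      have h' : ∀ i, (e i : Submodule F (Fin n → F)) = e' i := fun i =>
        congrFun (congrArg Subtype.val h) i
      have hSS : S = S' := by
        ext W
        constructor
        · intro hW
          obtain ⟨i, hi⟩ := e.surjective ⟨W, hW⟩
          have := (e' i).2
          rwa [← h', hi] at this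
        · intro hW
          obtain ⟨i, hi⟩ := e'.surjective ⟨W, hW⟩
          have := (e i).2
          rwa [h', hi] at this
      subst hSS
      congr 1
      ext i : 2
      exact h' i
    · rintro ⟨W, hb, hi, ht⟩
      have hinj : Function.Injective W := hi.injective hb
      refine ⟨⟨⟨Finset.univ.image W, ?_, ?_, ?_, ?_⟩,
        Equiv.ofBijective (fun i => ⟨W i, by simp⟩) ⟨?_, ?_⟩⟩, rfl⟩
      · simp [Finset.card_image_of_injective _ hinj]
      · simpa using hb
      · simpa using hi.sSupIndep_range
      · simpa [sSup_range] using ht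
      · exact fun i j h => hinj (congrArg Subtype.val h)
      · rintro ⟨U, hU⟩
        obtain ⟨i, -, rfl⟩ := Finset.mem_image.1 hU
        exact ⟨i, rfl⟩
  rw [← Nat.card_eq_of_bijective f hf, Nat.card_sigma, Finset.sum_congr rfl fun S _ => by
    rw [Nat.card_eq_fintype_card, Fintype.card_equiv (Fintype.equivOfCardEq (by simp [S.2.1])),
      Fintype.card_fin]]
  simp [T, splittingCount, mul_comm, Nat.card_eq_fintype_card]

theorem factorial_mul_splittingCount {F : Type} [Field F] [Fintype F] (q : ℕ)
    (hq : Fintype.card F = q) (n k : ℕ) :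
    ((k.factorial * splittingCount F n k : ℕ) : ℚ)
      = ∑ c ∈ (Fintype.piFinset fun _ : Fin k => Finset.Icc 1 n).filter
            (fun c => ∑ i, c i = n),
          (gam q n : ℚ) / ∏ i : Fin k, (gam q (c i) : ℚ) := by
  classical
  subst hq
  let _ : Fintype (Submodule F (Fin n → F)) := Fintype.ofFinite _
  rw [factorial_mul_splittingCount_eq_card, Nat.card_eq_fintype_card, Fintype.card_subtype,
    Finset.card_eq_sum_card_fiberwise (f := fun W i => finrank F (W i))
      (t := (Fintype.piFinset fun _ : Fin k => Finset.Icc 1 n).filter (fun c => ∑ i, c i = n)),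
    Nat.cast_sum]
  · refine Finset.sum_congr rfl fun c hc => ?_
    simp only [Finset.mem_filter, Fintype.mem_piFinset, Finset.mem_Icc] at hc
    have key := card_splittings_mul_prod_gam (F := F) (V := Fin n → F) c (by simpa using hc.2)
    rw [finrank_fin_fun, Nat.card_eq_fintype_card, Fintype.card_subtype] at key
    rw [eq_div_iff (Finset.prod_ne_zero_iff.2 fun i _ =>
      Nat.cast_ne_zero.2 (gam_pos Fintype.one_lt_card _).ne'), ← key]
    push_cast
    congr 3
    ext W
    simp only [Finset.mem_filter, Finset.mem_univ, true_and, funext_iff]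
    refine ⟨fun h => ⟨h.1.2, h.2⟩, fun h => ⟨⟨fun i hi => ?_, h.1⟩, h.2⟩⟩
    have h0 := h.2 i
    rw [hi, finrank_bot] at h0
    exact absurd (hc.1 i).1 (by omega)
  · intro W hW
    simp only [Finset.coe_filter, Finset.mem_univ, true_and, Set.mem_ofPred_eq] at hW
    have hs := sum_finrank_of_splitting hW.2.1 hW.2.2
    rw [finrank_fin_fun] at hs
    simp only [Finset.coe_filter, Set.mem_ofPred_eq, Fintype.mem_piFinset, Finset.mem_Icc]
    exact ⟨fun i => ⟨Submodule.one_le_finrank_iff.2 (hW.1 i),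
      (Submodule.finrank_le _).trans_eq (finrank_fin_fun F)⟩, hs⟩
end

section
/- The number of nilpotent n×n matrices over 𝔽_q equals q^{n(n−1)}. -/
open Module
open scoped Finset

theorem LinearIndependent.exists_basis_sum {F ι V : Type*} [Field F] [Fintype ι]
    [AddCommGroup V] [Module F V] [FiniteDimensional F V] {v : ι → V}
    (hv : LinearIndependent F v) {d : ℕ} (hd : Fintype.card ι + d = finrank F V) :
    ∃ b : Basis (ι ⊕ Fin d) F V, ∀ i, b (.inl i) = v i := by
  have b := Basis.sumExtend hv
  have hfin : Finite (Basis.sumExtendIndex hv) := by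
    have := Module.Finite.finite_basis b
    exact Finite.of_injective (Sum.inr : _ → ι ⊕ Basis.sumExtendIndex hv) Sum.inr_injective
  have := Fintype.ofFinite (Basis.sumExtendIndex hv)
  have hc := finrank_eq_card_basis b
  rw [Fintype.card_sum] at hc
  have e := Fintype.equivFinOfCardEq (show Fintype.card (Basis.sumExtendIndex hv) = d by omega)
  refine ⟨(Basis.sumExtend hv).reindex (Equiv.sumCongr (Equiv.refl ι) e), fun i => ?_⟩
  simp [Basis.sumExtend]
  rfl

section Block

variable {F ι κ : Type*} [Field F] [Fintype ι] [Fintype κ] [DecidableEq ι] [DecidableEq κ]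

theorem Matrix.isNilpotent_iff_charpoly_eq_X_pow (M : Matrix ι ι F) :
    IsNilpotent M ↔ M.charpoly = Polynomial.X ^ Fintype.card ι := by
  rw [← Matrix.isNilpotent_toLin'_iff, LinearMap.isNilpotent_iff_charpoly, Matrix.charpoly_toLin',
    finrank_fintype_fun_eq_card]

theorem Matrix.isNilpotent_fromBlocks_zero₂₁_iff {A : Matrix ι ι F} (hA : IsNilpotent A)
    (B : Matrix ι κ F) (D : Matrix κ κ F) :
    IsNilpotent (Matrix.fromBlocks A B 0 D) ↔ IsNilpotent D := by
  rw [Matrix.isNilpotent_iff_charpoly_eq_X_pow] at hA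
  rw [Matrix.isNilpotent_iff_charpoly_eq_X_pow, Matrix.isNilpotent_iff_charpoly_eq_X_pow,
    Matrix.charpoly_fromBlocks_zero₂₁, hA, Fintype.card_sum, pow_add]
  exact mul_right_inj' (pow_ne_zero _ Polynomial.X_ne_zero)

/-- Nilpotent block upper triangular matrices with prescribed nilpotent first diagonal block. -/
def nilpotentBlockEquiv {A : Matrix ι ι F} (hA : IsNilpotent A) :
    {M : Matrix (ι ⊕ κ) (ι ⊕ κ) F // IsNilpotent M ∧ M.toBlocks₁₁ = A ∧ M.toBlocks₂₁ = 0} ≃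
      Matrix ι κ F × {D : Matrix κ κ F // IsNilpotent D} where
  toFun M := ⟨M.1.toBlocks₁₂, M.1.toBlocks₂₂, by
    obtain ⟨M, hM, h₁, h₂⟩ := M
    subst h₁
    rw [← Matrix.fromBlocks_toBlocks M, h₂] at hM
    exact (Matrix.isNilpotent_fromBlocks_zero₂₁_iff hA _ _).1 hM⟩
  invFun P := ⟨Matrix.fromBlocks A P.1 0 P.2.1,
    (Matrix.isNilpotent_fromBlocks_zero₂₁_iff hA _ _).2 P.2.2, by simp, by simp⟩
  left_inv := by
    rintro ⟨M, hM, h₁, h₂⟩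
    ext1
    simp only [← h₁]
    rw [← h₂, Matrix.fromBlocks_toBlocks]
  right_inv P := by simp

theorem Module.Basis.toMatrix_blocks_iff {V : Type*} [AddCommGroup V] [Module F V]
    (b : Basis (ι ⊕ κ) F V) (A : Matrix ι ι F) (T : End F V) :
    (∀ i, T (b (.inl i)) = ∑ j, A j i • b (.inl j)) ↔
      (LinearMap.toMatrix b b T).toBlocks₁₁ = A ∧ (LinearMap.toMatrix b b T).toBlocks₂₁ = 0 := by
  have key (i : ι) : T (b (.inl i)) = ∑ j, A j i • b (.inl j) ↔
      (∀ j, (LinearMap.toMatrix b b T) (.inl j) (.inl i) = A j i) ∧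
        ∀ j, (LinearMap.toMatrix b b T) (.inr j) (.inl i) = 0 := by
    rw [b.ext_elem_iff, Sum.forall]
    simp [LinearMap.toMatrix_apply, Finsupp.single_apply]
  simp only [key, forall_and, ← Matrix.ext_iff, Matrix.toBlocks₁₁, Matrix.toBlocks₂₁,
    Matrix.of_apply, Matrix.zero_apply]
  exact and_congr forall_comm forall_comm

theorem LinearIndependent.card_nilpotent_extensions {V : Type*} [AddCommGroup V] [Module F V]
    [Finite F] [FiniteDimensional F V] {v : ι → V} (hv : LinearIndependent F v) {d : ℕ}
    (hd : Fintype.card ι + d = finrank F V) {A : Matrix ι ι F} (hA : IsNilpotent A) :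
    Nat.card {T : End F V // IsNilpotent T ∧ ∀ i, T (v i) = ∑ j, A j i • v j} =
      Nat.card F ^ (Fintype.card ι * d) *
        Nat.card {D : Matrix (Fin d) (Fin d) F // IsNilpotent D} := by
  obtain ⟨b, hb⟩ := hv.exists_basis_sum hd
  have e : {T : End F V // IsNilpotent T ∧ ∀ i, T (v i) = ∑ j, A j i • v j} ≃
      {M : Matrix (ι ⊕ Fin d) (ι ⊕ Fin d) F //
        IsNilpotent M ∧ M.toBlocks₁₁ = A ∧ M.toBlocks₂₁ = 0} := by
    refine (LinearMap.toMatrix b b).toEquiv.subtypeEquiv fun T => ?_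
    have := b.toMatrix_blocks_iff A T
    simp only [hb] at this
    rw [this]
    exact and_congr_left fun _ => (LinearMap.isNilpotent_toMatrix_iff b T).symm
  rw [Nat.card_congr e, Nat.card_congr (nilpotentBlockEquiv hA), Nat.card_prod]
  congr 1
  simp [Matrix, Nat.card_fun, ← pow_mul, mul_comm]

end Block

section Chain

variable {F V : Type*} [Field F] [AddCommGroup V] [Module F V]

/-- The matrix sending each standard basis vector to the next one, and the last one to zero. -/
def shiftMatrix (F : Type*) [Field F] (m : ℕ) : Matrix (Fin m) (Fin m) F :=
  Matrix.of fun j i => if (j : ℕ) = i + 1 then 1 else 0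

theorem isNilpotent_shiftMatrix (m : ℕ) : IsNilpotent (shiftMatrix F m) := by
  rw [Matrix.isNilpotent_iff_charpoly_eq_X_pow, ← Matrix.charpoly_transpose,
    Matrix.charpoly_of_isUpperTriangular]
  · simp [shiftMatrix]
  · intro i j hij
    have : (j : ℕ) < i := hij
    simp only [shiftMatrix, Matrix.transpose_apply, Matrix.of_apply]
    exact if_neg (by omega)

theorem forall_eq_sum_shiftMatrix_iff {k : ℕ} (v : Fin (k + 1) → V) (T : End F V) :
    (∀ i, T (v i) = ∑ j, shiftMatrix F (k + 1) j i • v j) ↔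
      (∀ i : Fin k, T (v i.castSucc) = v i.succ) ∧ T (v (Fin.last k)) = 0 := by
  rw [Fin.forall_fin_succ']
  refine and_congr (forall_congr' fun i => ?_) ?_
  · rw [Finset.sum_eq_single i.succ]
    · simp [shiftMatrix]
    · intro j _ hj
      have : (j : ℕ) ≠ i + 1 := fun h => hj (Fin.ext (by simpa using h))
      simp [shiftMatrix, this]
    · simp
  · rw [Finset.sum_eq_zero]
    intro j _
    have : (j : ℕ) ≠ k + 1 := by omega
    simp [shiftMatrix, this]

theorem apply_last_eq_zero_of_mem_span {k : ℕ} {v : Fin (k + 1) → V} (hv : LinearIndependent F v)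
    {T : End F V} (hT : IsNilpotent T) (hTv : ∀ i : Fin k, T (v i.castSucc) = v i.succ)
    (hlast : T (v (Fin.last k)) ∈ Submodule.span F (Set.range v)) : T (v (Fin.last k)) = 0 := by
  set W := Submodule.span F (Set.range v) with hW
  have hTW : ∀ x ∈ W, T x ∈ W := by
    intro x hx
    have : W ≤ W.comap T := by
      rw [hW, Submodule.span_le]
      rintro _ ⟨i, rfl⟩
      refine Fin.lastCases hlast (fun i => ?_) i
      change T _ ∈ W
      rw [hTv]
      exact Submodule.subset_span ⟨_, rfl⟩
    exact this hx
  have : Module.Finite F W := FiniteDimensional.span_of_finite F (Set.finite_range v)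
  have hpow : (T.restrict hTW) ^ (k + 1) = 0 := by
    have hnil : IsNilpotent (T.restrict hTW) := Module.End.isNilpotent.restrict hTW hT
    have := LinearMap.aeval_self_charpoly (T.restrict hTW)
    rwa [(LinearMap.isNilpotent_iff_charpoly _).1 hnil, finrank_span_eq_card hv, Fintype.card_fin,
      map_pow, Polynomial.aeval_X] at this
  have hiter : ∀ i : Fin (k + 1), (T ^ (i : ℕ)) (v 0) = v i := by
    intro i
    induction i using Fin.induction with
    | zero => simp
    | succ i ih =>
      rw [Fin.val_succ, pow_succ', Module.End.mul_apply, ← hTv, ← ih, Fin.val_castSucc]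
  have h0 : v 0 ∈ W := Submodule.subset_span ⟨_, rfl⟩
  have := congrArg Subtype.val (LinearMap.congr_fun hpow ⟨v 0, h0⟩)
  rw [Module.End.pow_restrict, LinearMap.restrict_apply] at this
  rw [← hiter, Fin.val_last, ← Module.End.mul_apply, ← pow_succ']
  simpa using this

open Classical in
/-- The number of nilpotent endomorphisms sending each vector of a linearly independent sequence
to the next one, given the number of nilpotent matrices of smaller sizes. -/
theorem card_nilpotent_chain [Finite F] [FiniteDimensional F V]
    (IH : ∀ m < finrank F V,
      Nat.card {D : Matrix (Fin m) (Fin m) F // IsNilpotent D} = Nat.card F ^ (m * (m - 1)))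
    (d k : ℕ) (hd : k + 1 + d = finrank F V) (v : Fin (k + 1) → V) (hv : LinearIndependent F v) :
    Nat.card {T : End F V // IsNilpotent T ∧ ∀ i : Fin k, T (v i.castSucc) = v i.succ} =
      Nat.card F ^ (finrank F V * d) := by
  have hV : Finite V := Module.finite_of_finite F
  have hE : Finite (End F V) := Module.finite_of_finite F
  have := Fintype.ofFinite V
  have hzero : Nat.card {T : End F V // IsNilpotent T ∧
      (∀ i : Fin k, T (v i.castSucc) = v i.succ) ∧ T (v (Fin.last k)) = 0} =
      Nat.card F ^ (d * (finrank F V - 1)) := by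
    simp_rw [← forall_eq_sum_shiftMatrix_iff]
    rw [hv.card_nilpotent_extensions (by simpa using hd) (isNilpotent_shiftMatrix _),
      IH d (by omega), ← pow_add, Fintype.card_fin]
    congr 1
    rw [← hd]
    rcases d with _ | d
    · simp
    · simp only [Nat.add_sub_cancel, Nat.add_succ_sub_one]
      ring
  set W := Submodule.span F (Set.range v)
  have hfib (w : V) (hw : w ∉ W) (e : ℕ) (he : d = e + 1) :
      Nat.card {T : End F V // IsNilpotent T ∧
        (∀ i : Fin k, T (v i.castSucc) = v i.succ) ∧ T (v (Fin.last k)) = w} =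
      Nat.card F ^ (finrank F V * e) := by
    rw [← card_nilpotent_chain IH e (k + 1) (by omega) (Fin.snoc v w)
      (linearIndependent_finSnoc.2 ⟨hv, hw⟩)]
    refine Nat.card_congr (Equiv.subtypeEquivRight fun T => and_congr_right fun _ => ?_)
    rw [Fin.forall_fin_succ']
    simp only [Fin.succ_castSucc, Fin.snoc_castSucc, Fin.succ_last, Fin.snoc_last]
  have hcardW : Nat.card W = Nat.card F ^ (k + 1) := by
    rw [Module.natCard_eq_pow_finrank (K := F), finrank_span_eq_card hv, Fintype.card_fin]
  have hcardV : Nat.card V = Nat.card F ^ finrank F V := Module.natCard_eq_pow_finrank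
  have hcompl : #{w : V | w ∉ W} + Nat.card F ^ (k + 1) = Nat.card F ^ finrank F V := by
    rw [← hcardW, ← hcardV, Nat.card_eq_fintype_card, Nat.card_eq_fintype_card,
      Fintype.card_subtype, add_comm]
    exact Finset.card_filter_add_card_filter_not _
  have hterm (w : V) : Nat.card {T : End F V // IsNilpotent T ∧
      (∀ i : Fin k, T (v i.castSucc) = v i.succ) ∧ T (v (Fin.last k)) = w} =
      (if w = 0 then Nat.card F ^ (d * (finrank F V - 1)) else 0) +
        if w ∉ W then Nat.card F ^ (finrank F V * (d - 1)) else 0 := by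
    by_cases hw : w ∈ W
    · rw [if_neg (not_not.2 hw), add_zero]
      split_ifs with h0
      · rw [h0, hzero]
      · rw [Nat.card_eq_zero]
        refine Or.inl ⟨fun ⟨T, hT, hTv, hTw⟩ => h0 ?_⟩
        rw [← hTw]
        exact apply_last_eq_zero_of_mem_span hv hT hTv (hTw ▸ hw)
    · rw [if_pos hw, if_neg (fun h : w = 0 => hw (h ▸ W.zero_mem)), zero_add]
      rcases d with _ | e
      · have : #{w : V | w ∉ W} = 0 := by
          rw [← hd] at hcompl
          simpa using hcompl
        rw [Finset.card_eq_zero, Finset.filter_eq_empty_iff] at this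
        exact absurd hw (this (Finset.mem_univ w))
      · exact hfib w hw e rfl
  have hsum : Nat.card {T : End F V // IsNilpotent T ∧
      ∀ i : Fin k, T (v i.castSucc) = v i.succ} =
      ∑ w : V, Nat.card {T : End F V // IsNilpotent T ∧
        (∀ i : Fin k, T (v i.castSucc) = v i.succ) ∧ T (v (Fin.last k)) = w} := by
    rw [← Nat.card_sigma]
    refine Nat.card_congr ((Equiv.sigmaFiberEquiv fun T => T.1 (v (Fin.last k))).symm.trans
      (Equiv.sigmaCongrRight fun w => ?_))
    refine (Equiv.subtypeSubtypeEquivSubtypeInter _ fun T : End F V =>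
      T (v (Fin.last k)) = w).trans (Equiv.subtypeEquivRight fun T => and_assoc)
  rw [hsum, Finset.sum_congr rfl fun w _ => hterm w, Finset.sum_add_distrib, Finset.sum_ite_eq',
    if_pos (Finset.mem_univ _), ← Finset.sum_filter, Finset.sum_const, smul_eq_mul]
  rcases d with _ | e
  · rw [← hd] at hcompl
    simp_all
  · have hexp : (e + 1) * (finrank F V - 1) = (k + 1) + finrank F V * e := by
      rw [← hd, show k + 1 + (e + 1) - 1 = k + 1 + e by omega]
      ring
    rw [hexp, Nat.add_sub_cancel, mul_add_one, pow_add, pow_add _ _ (finrank F V), ← hcompl]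
    ring

end Chain

theorem card_nilpotent_matrices {F : Type} [Field F] [Fintype F] (q : ℕ)
    (hq : Fintype.card F = q) (n : ℕ) :
    Nat.card {N : Matrix (Fin n) (Fin n) F // IsNilpotent N} = q ^ (n * (n - 1)) := by
  subst hq
  rw [← Nat.card_eq_fintype_card]
  induction n using Nat.strong_induction_on with
  | _ n IH =>
    rcases n with _ | n
    · have : Nonempty {N : Matrix (Fin 0) (Fin 0) F // IsNilpotent N} := ⟨0, IsNilpotent.zero⟩
      rw [Nat.zero_mul, pow_zero, Nat.card_unique]
    · have hrank : finrank F (Fin (n + 1) → F) = n + 1 := by simp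
      have hv : LinearIndependent F fun _ : Fin 1 => (1 : Fin (n + 1) → F) :=
        LinearIndependent.of_subsingleton 0 one_ne_zero
      have := card_nilpotent_chain (by rwa [hrank]) n 0 (by omega) _ hv
      rw [hrank] at this
      rw [Nat.add_sub_cancel, ← this]
      refine Nat.card_congr (Matrix.toLin'.toEquiv.subtypeEquiv fun N => ?_)
      simp
end
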